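/- Under hypotheses (H0)-(H4), for every t > ρ(P) and every unit vector q ∈ ℝ^{d-1} × [0,+∞), there exists a unique point a = â_t(q) ∈ Γ₊^t such that q belongs to the normal cone V_t(â_t(q)). -/

import Mathlib

open scoped Classical BigOperators
open Filter

noncomputable section

namespace RWHalfspace

/-- `ℤ^d` modeled as `ℤ^{d-1} × ℤ`; the Lean parameter `d` is the paper's `d-1`,
so that the paper's hypothesis `d ≥ 1` is automatic. -/
abbrev Zd (d : ℕ) := (Fin d → ℤ) × ℤ
/-- The state space `E = ℤ^{d-1} × ℕ`. -/
abbrev Ed (d : ℕ) := (Fin d → ℤ) × ℕ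
/-- `ℝ^d` modeled as `ℝ^{d-1} × ℝ`. -/
abbrev Rd (d : ℕ) := (Fin d → ℝ) × ℝ

variable {d : ℕ}

/-- The scalar product `a · z` for `a ∈ ℝ^d`, `z ∈ ℤ^d`. -/
def dotZ (a : Rd d) (z : Zd d) : ℝ := (∑ i, a.1 i * (z.1 i : ℝ)) + a.2 * (z.2 : ℝ)

/-- The scalar product on `ℝ^d`. -/
def dotR (a b : Rd d) : ℝ := (∑ i, a.1 i * b.1 i) + a.2 * b.2

/-- The scalar product `a · z` for `a ∈ ℝ^d`, `z ∈ E = ℤ^{d-1} × ℕ`. -/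
def dotE (a : Rd d) (z : Ed d) : ℝ := (∑ i, a.1 i * (z.1 i : ℝ)) + a.2 * (z.2 : ℝ)

/-- The jump generating function `φ(a) = ∑_{z ∈ ℤ^d} μ(z) e^{a·z}`. -/
def phi (μ : Zd d → ℝ) (a : Rd d) : ℝ := ∑' z, μ z * Real.exp (dotZ a z)

/-- The difference `z' - z ∈ ℤ^d` of two points of `E`. -/
def jump (z z' : Ed d) : Zd d := (z'.1 - z.1, (z'.2 : ℤ) - (z.2 : ℤ))

/-- The transition kernel of the reflected random walk on `E = ℤ^{d-1} × ℕ`. -/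
def ker (μ μ₀ : Zd d → ℝ) (z z' : Ed d) : ℝ :=
  if z.2 = 0 then μ₀ (jump z z') else μ (jump z z')

/-- The `n`-step transition kernel `p^(n)`. -/
def kerN (μ μ₀ : Zd d → ℝ) : ℕ → Ed d → Ed d → ℝ
  | 0 => fun z z' => if z = z' then 1 else 0
  | n + 1 => fun z z' => ∑' w, kerN μ μ₀ n z w * ker μ μ₀ w z'

/-- The `n`-step kernel of the homogeneous random walk on `ℤ^d` with step distribution `μ`. -/
def homN (μ : Zd d → ℝ) : ℕ → Zd d → Zd d → ℝ
  | 0 => fun z z' => if z = z' then 1 else 0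
  | n + 1 => fun z z' => ∑' w, homN μ n z w * μ (z' - w)

/-- The step distribution of the last coordinate of the homogeneous random walk. -/
def lastStep (μ : Zd d → ℝ) (k : ℤ) : ℝ := ∑' x : Fin d → ℤ, μ (x, k)

/-- The `n`-step kernel of the last coordinate random walk on `ℤ`. -/
def lastN (μ : Zd d → ℝ) : ℕ → ℤ → ℤ → ℝ
  | 0 => fun k k' => if k = k' then 1 else 0
  | n + 1 => fun k k' => ∑' j, lastN μ n k j * lastStep μ (k' - j)

/-- The convergence norm `ρ(P) = limsup_n (p^(n)(z,z'))^{1/n}` (independent of `z, z'`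
by irreducibility; we take `z = z' = 0`). -/
def rho (μ μ₀ : Zd d → ℝ) : ℝ :=
  limsup (fun n : ℕ => (kerN μ μ₀ n 0 0) ^ ((n : ℝ)⁻¹)) atTop

/-- `μ` is a nonnegative measure on `ℤ^d` with `0 < μ(ℤ^d) ≤ 1`. -/
def IsMeasure (μ : Zd d → ℝ) : Prop := (∀ z, 0 ≤ μ z) ∧ 0 < ∑' z, μ z ∧ ∑' z, μ z ≤ 1

/-- (H0): `μ(x,y) = 0` for `y < -1` and `μ₀(x,y) = 0` for `y < 0`. -/
def H0 (μ μ₀ : Zd d → ℝ) : Prop :=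
  (∀ z : Zd d, z.2 < -1 → μ z = 0) ∧ (∀ z : Zd d, z.2 < 0 → μ₀ z = 0)

/-- (H1): the kernel `P` is irreducible on `E`. -/
def H1 (μ μ₀ : Zd d → ℝ) : Prop := ∀ z z' : Ed d, ∃ n, 0 < kerN μ μ₀ n z z'

/-- (H2): the homogeneous random walk with step distribution `μ` is irreducible on `ℤ^d`. -/
def H2 (μ : Zd d → ℝ) : Prop := ∀ z z' : Zd d, ∃ n, 0 < homN μ n z z'

/-- (H3) for a single measure: the jump generating function is finite everywhere
(the defining series converges for every `a ∈ ℝ^d`). -/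
def H3 (μ : Zd d → ℝ) : Prop := ∀ a : Rd d, Summable fun z => μ z * Real.exp (dotZ a z)

/-- (H4): the last coordinate of the `μ`-random walk is aperiodic
(the gcd of `{n : p^n(0,0) > 0}` equals `1`). -/
def H4 (μ : Zd d → ℝ) : Prop := ∀ m : ℕ, (∀ n : ℕ, 0 < lastN μ n 0 0 → m ∣ n) → m = 1

/-- The sublevel set `D^t = {a : φ(a) ≤ t}`. -/
def Dset (μ : Zd d → ℝ) (t : ℝ) : Set (Rd d) := {a | phi μ a ≤ t}

/-- `Θ^t = {α ∈ ℝ^{d-1} : inf_β max(φ(α,β), φ₀(α,β)) ≤ t}`. -/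
def Theta (μ μ₀ : Zd d → ℝ) (t : ℝ) : Set (Fin d → ℝ) :=
  {α | sInf (Set.range fun β : ℝ => max (phi μ (α, β)) (phi μ₀ (α, β))) ≤ t}

/-- `Ĥ^t = (Θ^t × ℝ) ∩ D^t`. -/
def Hhat (μ μ₀ : Zd d → ℝ) (t : ℝ) : Set (Rd d) :=
  {a | a.1 ∈ Theta μ μ₀ t ∧ phi μ a ≤ t}

/-- Partial derivative of `f : ℝ^d → ℝ` in the last coordinate. -/
def dBeta (f : Rd d → ℝ) (a : Rd d) : ℝ := fderiv ℝ f a (0, 1)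

/-- The (coordinate) gradient of `f : ℝ^d → ℝ`. -/
def gradV (f : Rd d → ℝ) (a : Rd d) : Rd d :=
  (fun i => fderiv ℝ f a (Pi.single i 1, 0), fderiv ℝ f a (0, 1))

/-- `∂₊D^t`: boundary points of `D^t` where the last coordinate of `∇φ` is `≥ 0`. -/
def dPlus (μ : Zd d → ℝ) (t : ℝ) : Set (Rd d) :=
  {a | a ∈ frontier (Dset μ t) ∧ 0 ≤ dBeta (phi μ) a}

/-- `∂₀D^t`: boundary points of `D^t` where the last coordinate of `∇φ` is `0`. -/
def dZero (μ : Zd d → ℝ) (t : ℝ) : Set (Rd d) :=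
  {a | a ∈ frontier (Dset μ t) ∧ dBeta (phi μ) a = 0}

/-- `Γ₊^t = Ĥ^t ∩ ∂₊D^t`. -/
def GammaPlus (μ μ₀ : Zd d → ℝ) (t : ℝ) : Set (Rd d) := Hhat μ μ₀ t ∩ dPlus μ t

/-- The normal cone `V_t(a)` to `Ĥ^t` at `a`. -/
def Vcone (μ μ₀ : Zd d → ℝ) (t : ℝ) (a : Rd d) : Set (Rd d) :=
  {q | ∀ a' ∈ Hhat μ μ₀ t, dotR q (a' - a) ≤ 0}

/-- `β̄ = min{b : φ(α,b) ≤ t}`. -/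
def betaBar (μ : Zd d → ℝ) (t : ℝ) (α : Fin d → ℝ) : ℝ := sInf {b : ℝ | phi μ (α, b) ≤ t}

/-- `ā^t`: the lowest point of `D^t` with the same first `d-1` coordinates as `a`. -/
def abar (μ : Zd d → ℝ) (t : ℝ) (a : Rd d) : Rd d := (a.1, betaBar μ t a.1)

/-- The Green function `G_t(z,z') = ∑_n t^{-n} p^(n)(z,z')`. -/
def green (μ μ₀ : Zd d → ℝ) (t : ℝ) (z z' : Ed d) : ℝ :=
  ∑' n, (t ^ n)⁻¹ * kerN μ μ₀ n z z'

/-- The `t`-Martin kernel `K_t(z,z') = G_t(z,z')/G_t(z₀,z')` with reference point `z₀`. -/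
def martin (μ μ₀ : Zd d → ℝ) (t : ℝ) (z₀ z z' : Ed d) : ℝ :=
  green μ μ₀ t z z' / green μ μ₀ t z₀ z'

/-- Euclidean norm on `ℝ^d = ℝ^{d-1} × ℝ`. -/
def euclNorm (a : Rd d) : ℝ := Real.sqrt ((∑ i, a.1 i ^ 2) + a.2 ^ 2)

/-- The point of `ℝ^d` corresponding to `z ∈ E`. -/
def vecE (z : Ed d) : Rd d := (fun i => (z.1 i : ℝ), (z.2 : ℝ))

/-- Euclidean distance from a point `v` to a set `S ⊆ ℝ^d`. -/
def distTo (S : Set (Rd d)) (v : Rd d) : ℝ := sInf ((fun q => euclNorm (v - q)) '' S)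

/-- The function `h_{a,t}` of the paper. -/
def hFun (μ μ₀ : Zd d → ℝ) (t : ℝ) (a : Rd d) (z : Ed d) : ℝ :=
  if a ∉ dZero μ t ∧ phi μ₀ (abar μ t a) < t then
    Real.exp (dotE a z)
      - ((t - phi μ₀ a) / (t - phi μ₀ (abar μ t a))) * Real.exp (dotE (abar μ t a) z)
  else if a = abar μ t a ∧ a ∈ dZero μ t ∧ phi μ₀ a < t then
    ((z.2 : ℝ) + dBeta (phi μ₀) a / (t - phi μ₀ a)) * Real.exp (dotE a z)
  else Real.exp (dotE (abar μ t a) z)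



/-- `dotZ` as a continuous linear map. -/
def ellZ (z : Zd d) : Rd d →L[ℝ] ℝ :=
  LinearMap.toContinuousLinearMap
    { toFun := fun a => dotZ a z
      map_add' := by
        intro a b
        simp [dotZ, add_mul, Finset.sum_add_distrib]; ring
      map_smul' := by
        intro c a
        simp [dotZ, mul_assoc, Finset.mul_sum, mul_add] }

lemma ellZ_apply (z : Zd d) (a : Rd d) : ellZ z a = dotZ a z := rfl

lemma dotZ_add (a b : Rd d) (z : Zd d) : dotZ (a + b) z = dotZ a z + dotZ b z := by
  simp only [← ellZ_apply, map_add]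

lemma dotZ_smul (c : ℝ) (a : Rd d) (z : Zd d) : dotZ (c • a) z = c * dotZ a z := by
  simp only [← ellZ_apply, map_smul, smul_eq_mul]

lemma dotZ_sub (a b : Rd d) (z : Zd d) : dotZ (a - b) z = dotZ a z - dotZ b z := by
  simp only [← ellZ_apply, map_sub]

lemma dotZ_add_right (a : Rd d) (z w : Zd d) : dotZ a (z + w) = dotZ a z + dotZ a w := by
  simp [dotZ, mul_add, Finset.sum_add_distrib]; ring

/-- The `ℓ¹` size of a lattice point. -/
def nrm (z : Zd d) : ℝ := (∑ i, |(z.1 i : ℝ)|) + |(z.2 : ℝ)|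

lemma nrm_nonneg (z : Zd d) : 0 ≤ nrm z := by unfold nrm; positivity

lemma abs_dotZ_le (a : Rd d) (z : Zd d) : |dotZ a z| ≤ nrm z * ‖a‖ := by
  unfold dotZ nrm
  rw [add_mul, Finset.sum_mul]
  refine (abs_add_le _ _).trans (add_le_add ((Finset.abs_sum_le_sum_abs _ _).trans
    (Finset.sum_le_sum fun i _ => ?_)) ?_)
  · rw [abs_mul, mul_comm]
    refine mul_le_mul_of_nonneg_left ?_ (abs_nonneg _)
    exact (norm_le_pi_norm a.1 i).trans (norm_fst_le a)
  · rw [abs_mul, mul_comm]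
    exact mul_le_mul_of_nonneg_left (norm_snd_le a) (abs_nonneg _)

lemma norm_ellZ_le (z : Zd d) : ‖ellZ z‖ ≤ nrm z :=
  ContinuousLinearMap.opNorm_le_bound _ (nrm_nonneg z) (fun a => abs_dotZ_le a z)

/-- A sign vector. -/
def sgnv (s : (Fin d → Bool) × Bool) : Rd d :=
  (fun i => if s.1 i then 2 else -2, if s.2 then 2 else -2)

lemma exists_sgnv (z : Zd d) : ∃ s : (Fin d → Bool) × Bool, dotZ (sgnv s) z = 2 * nrm z := by
  refine ⟨(fun i => decide (0 ≤ z.1 i), decide (0 ≤ z.2)), ?_⟩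
  have key : ∀ k : ℤ, (if decide (0 ≤ k) = true then (2:ℝ) else -2) * (k:ℝ) = 2 * |(k:ℝ)| := by
    intro k
    by_cases hk : 0 ≤ k
    · have : (0:ℝ) ≤ k := by exact_mod_cast hk
      simp [hk, abs_of_nonneg this]
    · have : (k:ℝ) < 0 := by exact_mod_cast (not_le.mp hk)
      simp [hk, abs_of_neg this]
  unfold dotZ nrm sgnv
  rw [mul_add, Finset.mul_sum]
  congr 1
  · exact Finset.sum_congr rfl fun i _ => key _
  · exact key _

lemma summable_big {μ : Zd d → ℝ} (hμ : ∀ z, 0 ≤ μ z) (h3 : H3 μ) (a : Rd d) :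
    Summable fun z => μ z * Real.exp (dotZ a z + 2 * nrm z) := by
  have hs : Summable fun z => ∑ s : (Fin d → Bool) × Bool, μ z * Real.exp (dotZ (a + sgnv s) z) :=
    summable_sum fun s _ => h3 (a + sgnv s)
  refine Summable.of_nonneg_of_le (fun z => mul_nonneg (hμ z) (Real.exp_pos _).le) (fun z => ?_) hs
  obtain ⟨s, hs⟩ := exists_sgnv z
  rw [← hs, ← dotZ_add]
  exact Finset.single_le_sum (f := fun s => μ z * Real.exp (dotZ (a + sgnv s) z))
    (fun s _ => mul_nonneg (hμ z) (Real.exp_pos _).le) (Finset.mem_univ s)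

lemma phi_diff {μ : Zd d → ℝ} (hμ : ∀ z, 0 ≤ μ z) (h3 : H3 μ) : Differentiable ℝ (phi μ) := by
  intro a
  have := hasFDerivAt_tsum_of_isPreconnected (𝕜 := ℝ) (summable_big hμ h3 a)
    (s := Metric.ball a 1) Metric.isOpen_ball (convex_ball a 1).isPreconnected
    (f := fun z b => μ z * Real.exp (dotZ b z))
    (f' := fun z b => μ z • (Real.exp (dotZ b z) • ellZ z)) (x₀ := a) (x := a)
    (fun z b _ => ?_) (fun z b hb => ?_) (Metric.mem_ball_self one_pos) (h3 a)
    (Metric.mem_ball_self one_pos)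
  · exact this.differentiableAt
  · exact ((ellZ z).hasFDerivAt.exp).const_mul (μ z)
  · rw [norm_smul, norm_smul, Real.norm_of_nonneg (hμ z), Real.norm_of_nonneg (Real.exp_pos _).le]
    refine mul_le_mul_of_nonneg_left ?_ (hμ z)
    have h1 : dotZ b z ≤ dotZ a z + nrm z := by
      have h2 : dotZ (b - a) z ≤ nrm z * 1 := (le_abs_self _).trans ((abs_dotZ_le _ z).trans
        (mul_le_mul_of_nonneg_left (mem_ball_iff_norm.mp hb).le (nrm_nonneg z)))
      rw [dotZ_sub] at h2; linarith
    calc Real.exp (dotZ b z) * ‖ellZ z‖ ≤ Real.exp (dotZ a z + nrm z) * Real.exp (nrm z) := by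
          refine mul_le_mul (Real.exp_le_exp.mpr h1) ?_ (norm_nonneg _) (Real.exp_pos _).le
          exact (norm_ellZ_le z).trans (by linarith [Real.add_one_le_exp (nrm z)])
      _ = _ := by rw [← Real.exp_add]; ring_nf

lemma phi_cont {μ : Zd d → ℝ} (hμ : ∀ z, 0 ≤ μ z) (h3 : H3 μ) : Continuous (phi μ) :=
  (phi_diff hμ h3).continuous

lemma phi_convex {μ : Zd d → ℝ} (hμ : ∀ z, 0 ≤ μ z) (h3 : H3 μ) :
    ConvexOn ℝ Set.univ (phi μ) := by
  refine ⟨convex_univ, fun a _ b _ s r hs hr hsr => ?_⟩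
  have h := (((h3 a).mul_left s).add ((h3 b).mul_left r))
  have e : s • phi μ a + r • phi μ b =
      ∑' z, (s * (μ z * Real.exp (dotZ a z)) + r * (μ z * Real.exp (dotZ b z))) := by
    rw [((h3 a).mul_left s).tsum_add ((h3 b).mul_left r), tsum_mul_left, tsum_mul_left]; rfl
  rw [e]
  refine Summable.tsum_le_tsum (fun z => ?_) (h3 _) h
  rw [dotZ_add, dotZ_smul, dotZ_smul]
  have := convexOn_exp.2 (Set.mem_univ (dotZ a z)) (Set.mem_univ (dotZ b z)) hs hr hsr
  simp only [smul_eq_mul] at this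
  nlinarith [mul_le_mul_of_nonneg_left this (hμ z)]

/-- Induction principle given by the irreducibility of the homogeneous walk. -/
lemma hom_induction {μ : Zd d → ℝ} (hμ : ∀ z, 0 ≤ μ z) (h2 : H2 μ) (S : Zd d → Prop)
    (hS0 : S 0) (hS : ∀ z w, S z → 0 < μ w → S (z + w)) : ∀ z, S z := by
  have hnn : ∀ n z w, 0 ≤ homN μ n z w := by
    intro n
    induction n with
    | zero => intro z w; simp only [homN]; split_ifs <;> norm_num
    | succ n ih => intro z w; exact tsum_nonneg fun v => mul_nonneg (ih _ _) (hμ _)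
  have key : ∀ n z, 0 < homN μ n 0 z → S z := by
    intro n
    induction n with
    | zero =>
      intro z hz
      simp only [homN] at hz
      split_ifs at hz with h
      · exact h ▸ hS0
      · exact absurd hz (lt_irrefl _)
    | succ n ih =>
      intro z hz
      by_contra hcon
      have : ∀ w, homN μ n 0 w * μ (z - w) = 0 := by
        intro w
        by_contra hne
        have h1 : 0 < homN μ n 0 w := lt_of_le_of_ne (hnn _ _ _) (Ne.symm (left_ne_zero_of_mul hne))
        have h2 : 0 < μ (z - w) := lt_of_le_of_ne (hμ _) (Ne.symm (right_ne_zero_of_mul hne))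
        have := hS w (z - w) (ih w h1) h2
        rw [add_sub_cancel] at this
        exact hcon this
      simp only [homN, this, tsum_zero] at hz
      exact lt_irrefl _ hz
  intro z
  obtain ⟨n, hn⟩ := h2 0 z
  exact key n z hn

lemma dotZ_zero_right (a : Rd d) : dotZ a 0 = 0 := by simp [dotZ]

lemma exists_pos_dir {μ : Zd d → ℝ} (hμ : ∀ z, 0 ≤ μ z) (h2 : H2 μ) (u : Rd d) (z : Zd d)
    (hz : 0 < dotZ u z) : ∃ w, 0 < μ w ∧ 0 < dotZ u w := by
  by_contra! hcon
  have := hom_induction hμ h2 (fun z => dotZ u z ≤ 0) (by simp [dotZ_zero_right])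
    (fun z w h1 h2 => by rw [dotZ_add_right]; linarith [hcon w h2]) z
  linarith

lemma dotZ_single (a : Rd d) (i : Fin d) (k : ℤ) : dotZ a (Pi.single i k, 0) = a.1 i * k := by
  simp only [dotZ, Int.cast_zero, mul_zero, add_zero]
  rw [Finset.sum_eq_single i]
  · simp
  · intro j _ hj; simp [Pi.single_eq_of_ne hj]
  · simp

lemma dotZ_last (a : Rd d) (k : ℤ) : dotZ a (0, k) = a.2 * k := by
  simp [dotZ]

lemma exists_dot_ne {μ : Zd d → ℝ} (hμ : ∀ z, 0 ≤ μ z) (h2 : H2 μ) (u : Rd d) (hu : u ≠ 0) :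
    ∃ w, 0 < μ w ∧ dotZ u w ≠ 0 := by
  have : ∃ z, 0 < dotZ u z := by
    by_contra! hcon
    apply hu
    ext i
    · have h1 := hcon (Pi.single i 1, 0)
      have h2 := hcon (Pi.single i (-1), 0)
      rw [dotZ_single] at h1 h2
      push_cast at h1 h2
      simp only [Prod.fst_zero, Pi.zero_apply]; linarith
    · have h1 := hcon (0, 1)
      have h2 := hcon (0, -1)
      rw [dotZ_last] at h1 h2
      push_cast at h1 h2
      simp only [Prod.snd_zero]; linarith
  obtain ⟨z, hz⟩ := this
  obtain ⟨w, h1, h2⟩ := exists_pos_dir hμ h2 u z hz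
  exact ⟨w, h1, h2.ne'⟩

lemma term_le_phi {μ : Zd d → ℝ} (hμ : ∀ z, 0 ≤ μ z) (h3 : H3 μ) (a : Rd d) (z : Zd d) :
    μ z * Real.exp (dotZ a z) ≤ phi μ a :=
  (h3 a).le_tsum z fun w _ => mul_nonneg (hμ w) (Real.exp_pos _).le

lemma dset_bdd {μ : Zd d → ℝ} (hμ : ∀ z, 0 ≤ μ z) (h2 : H2 μ) (h3 : H3 μ) (s : ℝ) (z : Zd d) :
    ∃ C, ∀ a ∈ Dset μ s, dotZ a z ≤ C := by
  refine hom_induction hμ h2 (fun z => ∃ C, ∀ a ∈ Dset μ s, dotZ a z ≤ C) ⟨0, fun a _ => by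
    simp [dotZ_zero_right]⟩ ?_ z
  rintro z w ⟨C, hC⟩ hw
  refine ⟨C + Real.log (s / μ w), fun a ha => ?_⟩
  rw [dotZ_add_right]
  have h1 : Real.exp (dotZ a w) ≤ s / μ w := by
    rw [le_div_iff₀ hw, mul_comm]
    exact (term_le_phi hμ h3 a w).trans ha
  have h2 := Real.log_le_log (Real.exp_pos _) h1
  rw [Real.log_exp] at h2
  linarith [hC a ha]

lemma dset_compact {μ : Zd d → ℝ} (hμ : ∀ z, 0 ≤ μ z) (h2 : H2 μ) (h3 : H3 μ) (s : ℝ) :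
    IsCompact (Dset μ s) := by
  choose C hC using dset_bdd hμ h2 h3 s
  have hclosed : IsClosed (Dset μ s) := isClosed_le (phi_cont hμ h3) continuous_const
  let lo : Rd d := (fun i => -C (Pi.single i (-1), 0), -C (0, -1))
  let hi : Rd d := (fun i => C (Pi.single i 1, 0), C (0, 1))
  refine (isCompact_Icc (a := lo) (b := hi)).of_isClosed_subset hclosed fun a ha => ?_
  refine ⟨⟨fun i => ?_, ?_⟩, ⟨fun i => ?_, ?_⟩⟩
  · have := hC (Pi.single i (-1), 0) a ha
    rw [dotZ_single] at this; push_cast at this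
    simp only [lo]; linarith
  · have := hC (0, -1) a ha
    rw [dotZ_last] at this; push_cast at this
    simp only [lo]; linarith
  · have := hC (Pi.single i 1, 0) a ha
    rw [dotZ_single] at this; push_cast at this
    simp only [hi]; linarith
  · have := hC (0, 1) a ha
    rw [dotZ_last] at this; push_cast at this
    simp only [hi]; linarith

lemma phi_mid_lt {μ : Zd d → ℝ} (hμ : ∀ z, 0 ≤ μ z) (h2 : H2 μ) (h3 : H3 μ) (a b : Rd d)
    (hab : a ≠ b) : phi μ ((1/2:ℝ) • a + (1/2:ℝ) • b) < (1/2) * phi μ a + (1/2) * phi μ b := by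
  obtain ⟨w, hw, hne⟩ := exists_dot_ne hμ h2 (a - b) (sub_ne_zero.mpr hab)
  rw [dotZ_sub, sub_ne_zero] at hne
  have h := (((h3 a).mul_left (1/2)).add ((h3 b).mul_left (1/2)))
  have e : (1/2) * phi μ a + (1/2) * phi μ b =
      ∑' z, ((1/2) * (μ z * Real.exp (dotZ a z)) + (1/2) * (μ z * Real.exp (dotZ b z))) := by
    rw [((h3 a).mul_left _).tsum_add ((h3 b).mul_left _), tsum_mul_left, tsum_mul_left]; rfl
  rw [e]
  refine Summable.tsum_lt_tsum (i := w) (fun z => ?_) ?_ (h3 _) h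
  · rw [dotZ_add, dotZ_smul, dotZ_smul]
    have := convexOn_exp.2 (Set.mem_univ (dotZ a z)) (Set.mem_univ (dotZ b z))
      (show (0:ℝ) ≤ 1/2 by norm_num) (show (0:ℝ) ≤ 1/2 by norm_num) (by norm_num)
    simp only [smul_eq_mul] at this
    nlinarith [mul_le_mul_of_nonneg_left this (hμ z)]
  · rw [dotZ_add, dotZ_smul, dotZ_smul]
    have := strictConvexOn_exp.2 (Set.mem_univ (dotZ a w)) (Set.mem_univ (dotZ b w)) hne
      (show (0:ℝ) < 1/2 by norm_num) (show (0:ℝ) < 1/2 by norm_num) (by norm_num)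
    simp only [smul_eq_mul] at this
    nlinarith [mul_lt_mul_of_pos_left this hw]

/-- Bounded sequences. -/
def Bdd (u : ℕ → ℝ) : Prop := ∃ C, ∀ n, |u n| ≤ C

/-- Cesàro averages. -/
def ces (u : ℕ → ℝ) (n : ℕ) : ℝ := (∑ k ∈ Finset.range n, u k) / n

/-- A Banach limit. -/
def LL (u : ℕ → ℝ) : ℝ := limUnder (hyperfilter ℕ : Filter ℕ) (ces u)

lemma ces_bdd {u : ℕ → ℝ} {C : ℝ} (h : ∀ n, |u n| ≤ C) (n : ℕ) : |ces u n| ≤ C := by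
  have hC : 0 ≤ C := (abs_nonneg _).trans (h 0)
  unfold ces
  rcases Nat.eq_zero_or_pos n with rfl | hn
  · simpa using hC
  · have hn' : (0:ℝ) < n := by exact_mod_cast hn
    rw [abs_div, abs_of_pos hn', div_le_iff₀ hn']
    calc |∑ k ∈ Finset.range n, u k| ≤ ∑ k ∈ Finset.range n, |u k| := Finset.abs_sum_le_sum_abs _ _
      _ ≤ ∑ k ∈ Finset.range n, C := Finset.sum_le_sum fun k _ => h k
      _ = C * n := by simp [mul_comm]

lemma LL_tendsto {u : ℕ → ℝ} (h : Bdd u) :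
    Tendsto (ces u) (hyperfilter ℕ : Filter ℕ) (nhds (LL u)) := by
  obtain ⟨C, hC⟩ := h
  have hmem : ∀ n, ces u n ∈ Set.Icc (-C) C := fun n => abs_le.mp (ces_bdd hC n)
  obtain ⟨x, -, hx⟩ := (isCompact_Icc (a := -C) (b := C)).ultrafilter_le_nhds
    ((hyperfilter ℕ).map (ces u)) (by
      rw [Filter.le_principal_iff]
      exact Filter.mem_map.mpr (Filter.univ_mem' hmem))
  exact tendsto_nhds_limUnder ⟨x, hx⟩

lemma LL_eq {u : ℕ → ℝ} {x : ℝ} (h : Tendsto (ces u) (hyperfilter ℕ : Filter ℕ) (nhds x)) :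
    LL u = x := h.limUnder_eq

lemma Bdd.add {u v : ℕ → ℝ} (hu : Bdd u) (hv : Bdd v) : Bdd (fun n => u n + v n) := by
  obtain ⟨C, hC⟩ := hu
  obtain ⟨D, hD⟩ := hv
  exact ⟨C + D, fun n => (abs_add_le _ _).trans (add_le_add (hC n) (hD n))⟩

lemma Bdd.const_mul {u : ℕ → ℝ} (c : ℝ) (hu : Bdd u) : Bdd (fun n => c * u n) := by
  obtain ⟨C, hC⟩ := hu
  refine ⟨|c| * C, fun n => ?_⟩
  rw [abs_mul]
  exact mul_le_mul_of_nonneg_left (hC n) (abs_nonneg _)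

lemma bdd_const (c : ℝ) : Bdd (fun _ => c) := ⟨|c|, fun _ => le_rfl⟩

lemma LL_add {u v : ℕ → ℝ} (hu : Bdd u) (hv : Bdd v) : LL (fun n => u n + v n) = LL u + LL v := by
  apply LL_eq
  have := (LL_tendsto hu).add (LL_tendsto hv)
  refine this.congr fun n => ?_
  simp [ces, Finset.sum_add_distrib, add_div]

lemma LL_const_mul {u : ℕ → ℝ} (c : ℝ) (hu : Bdd u) : LL (fun n => c * u n) = c * LL u := by
  apply LL_eq
  refine ((LL_tendsto hu).const_mul c).congr fun n => ?_
  simp [ces, ← Finset.mul_sum, mul_div_assoc]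

lemma LL_le {u : ℕ → ℝ} {c : ℝ} (hu : Bdd u) (h : ∀ n, u n ≤ c) : LL u ≤ c := by
  refine le_of_tendsto (LL_tendsto hu) ?_
  have : ∀ᶠ n : ℕ in (hyperfilter ℕ : Filter ℕ), 0 < n :=
    (Nat.hyperfilter_le_atTop) (Filter.eventually_gt_atTop 0)
  filter_upwards [this] with n hn
  have hn' : (0:ℝ) < n := by exact_mod_cast hn
  unfold ces
  rw [div_le_iff₀ hn']
  calc _ ≤ ∑ k ∈ Finset.range n, c := Finset.sum_le_sum fun k _ => h k
    _ = c * n := by simp [mul_comm]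

lemma LL_const (c : ℝ) : LL (fun _ => c) = c := by
  apply le_antisymm (LL_le (bdd_const c) fun _ => le_rfl)
  have := LL_le (bdd_const (-c)) (fun _ => le_rfl)
  have h2 := LL_const_mul (-1) (bdd_const c)
  simp only [neg_mul, one_mul] at h2
  linarith

lemma LL_succ {u : ℕ → ℝ} (hu : Bdd u) : LL (fun n => u (n+1)) = LL u := by
  apply LL_eq
  obtain ⟨C, hC⟩ := hu
  have h0 : Tendsto (fun n : ℕ => (u n - u 0) / (n:ℝ)) atTop (nhds 0) := by
    have hb : Tendsto (fun n : ℕ => (2 * C) / (n:ℝ)) atTop (nhds 0) :=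
      tendsto_const_div_atTop_nhds_zero_nat _
    refine squeeze_zero_norm (fun n => ?_) hb
    rw [norm_div, Real.norm_natCast, Real.norm_eq_abs]
    refine div_le_div_of_nonneg_right ?_ (Nat.cast_nonneg n)
    have := abs_sub (u n) (u 0)
    linarith [hC n, hC 0, abs_sub (u n) (u 0)]
  have h1 := (LL_tendsto ⟨C, hC⟩).add (h0.mono_left Nat.hyperfilter_le_atTop)
  rw [add_zero] at h1
  refine h1.congr fun n => ?_
  unfold ces
  rw [← add_div]
  congr 1
  have e1 := Finset.sum_range_succ u n
  have e2 := Finset.sum_range_succ' u n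
  linarith

lemma LL_sum {ι : Type*} (F : Finset ι) (c : ι → ℝ) (u : ι → ℕ → ℝ) (hu : ∀ i, Bdd (u i)) :
    Bdd (fun n => ∑ i ∈ F, c i * u i n) ∧
    LL (fun n => ∑ i ∈ F, c i * u i n) = ∑ i ∈ F, c i * LL (u i) := by
  induction F using Finset.induction_on with
  | empty => simp only [Finset.sum_empty]; exact ⟨bdd_const 0, LL_const 0⟩
  | insert a s ha ih =>
    simp only [Finset.sum_insert ha]
    exact ⟨((hu a).const_mul _).add ih.1, by
      rw [LL_add ((hu a).const_mul _) ih.1, LL_const_mul _ (hu a), ih.2]⟩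

/-- Superharmonicity of `exp G`. -/
def Super (μ μ₀ : Zd d → ℝ) (t : ℝ) (G : Ed d → ℝ) : Prop :=
  ∀ (z : Ed d) (F : Finset (Ed d)), ∑ z' ∈ F, ker μ μ₀ z z' * Real.exp (G z' - G z) ≤ t

lemma jump_tr (z z' : Ed d) (x : Fin d → ℤ) : jump (z + (x, 0)) (z' + (x, 0)) = jump z z' := by
  simp [jump]

lemma ker_tr (μ μ₀ : Zd d → ℝ) (z z' : Ed d) (x : Fin d → ℤ) :
    ker μ μ₀ (z + (x, 0)) (z' + (x, 0)) = ker μ μ₀ z z' := by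
  simp only [ker, jump_tr, Prod.snd_add, add_zero]

lemma ker_nonneg {μ μ₀ : Zd d → ℝ} (hμ : ∀ z, 0 ≤ μ z) (hμ₀ : ∀ z, 0 ≤ μ₀ z) (z z' : Ed d) :
    0 ≤ ker μ μ₀ z z' := by
  unfold ker; split_ifs
  · exact hμ₀ _
  · exact hμ _

lemma kerN_nonneg {μ μ₀ : Zd d → ℝ} (hμ : ∀ z, 0 ≤ μ z) (hμ₀ : ∀ z, 0 ≤ μ₀ z) (n : ℕ) :
    ∀ (z z' : Ed d), 0 ≤ kerN μ μ₀ n z z' := by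
  induction n with
  | zero => intro z w; simp only [kerN]; split_ifs <;> norm_num
  | succ n ih => intro z w; exact tsum_nonneg fun v => mul_nonneg (ih _ _) (ker_nonneg hμ hμ₀ _ _)

/-- Induction principle from irreducibility of `P`. -/
lemma ker_induction {μ μ₀ : Zd d → ℝ} (hμ : ∀ z, 0 ≤ μ z) (hμ₀ : ∀ z, 0 ≤ μ₀ z) (h1 : H1 μ μ₀)
    (z : Ed d) (S : Ed d → Prop) (hS0 : S z)
    (hS : ∀ w w', S w → 0 < ker μ μ₀ w w' → S w') : ∀ w, S w := by
  have key : ∀ n w, 0 < kerN μ μ₀ n z w → S w := by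
    intro n
    induction n with
    | zero =>
      intro w hw
      simp only [kerN] at hw
      split_ifs at hw with h
      · exact h ▸ hS0
      · exact absurd hw (lt_irrefl _)
    | succ n ih =>
      intro w hw
      by_contra hcon
      have : ∀ v, kerN μ μ₀ n z v * ker μ μ₀ v w = 0 := by
        intro v
        by_contra hne
        have h1 : 0 < kerN μ μ₀ n z v :=
          lt_of_le_of_ne (kerN_nonneg hμ hμ₀ _ _ _) (Ne.symm (left_ne_zero_of_mul hne))
        have h2 : 0 < ker μ μ₀ v w :=
          lt_of_le_of_ne (ker_nonneg hμ hμ₀ _ _) (Ne.symm (right_ne_zero_of_mul hne))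
        exact hcon (hS v w (ih v h1) h2)
      simp only [kerN, this, tsum_zero] at hw
      exact lt_irrefl _ hw
  intro w
  obtain ⟨n, hn⟩ := h1 z w
  exact key n w hn

lemma harnack {μ μ₀ : Zd d → ℝ} (hμ : ∀ z, 0 ≤ μ z) (hμ₀ : ∀ z, 0 ≤ μ₀ z) (h1 : H1 μ μ₀)
    {t : ℝ} {G : Ed d → ℝ} (hG : Super μ μ₀ t G) (z z' : Ed d) :
    ∃ c, ∀ x : Fin d → ℤ, G (z' + (x, 0)) - G (z + (x, 0)) ≤ c := by
  refine ker_induction hμ hμ₀ h1 z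
    (fun z' => ∃ c, ∀ x : Fin d → ℤ, G (z' + (x, 0)) - G (z + (x, 0)) ≤ c) ⟨0, by simp⟩ ?_ z'
  rintro w w' ⟨c, hc⟩ hw
  refine ⟨c + Real.log (t / ker μ μ₀ w w'), fun x => ?_⟩
  have h := hG (w + (x, 0)) {w' + (x, 0)}
  rw [Finset.sum_singleton, ker_tr] at h
  have h1 : Real.exp (G (w' + (x, 0)) - G (w + (x, 0))) ≤ t / ker μ μ₀ w w' := by
    rw [le_div_iff₀ hw, mul_comm]; exact h
  have h2 := Real.log_le_log (Real.exp_pos _) h1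
  rw [Real.log_exp] at h2
  linarith [hc x]

lemma harnack_bdd {μ μ₀ : Zd d → ℝ} (hμ : ∀ z, 0 ≤ μ z) (hμ₀ : ∀ z, 0 ≤ μ₀ z) (h1 : H1 μ μ₀)
    {t : ℝ} {G : Ed d → ℝ} (hG : Super μ μ₀ t G) (z z' : Ed d) (x : ℕ → Fin d → ℤ) :
    Bdd (fun k => G (z' + (x k, 0)) - G (z + (x k, 0))) := by
  obtain ⟨c, hc⟩ := harnack hμ hμ₀ h1 hG z z'
  obtain ⟨c', hc'⟩ := harnack hμ hμ₀ h1 hG z' z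
  refine ⟨max c c', fun k => abs_le.mpr ⟨?_, ?_⟩⟩
  · have := hc' (x k)
    have := le_max_right c c'
    linarith
  · exact (hc _).trans (le_max_left _ _)

/-- The shifted sequence of directions. -/
def xs (i : Fin d) (k : ℕ) : Fin d → ℤ := Pi.single i (k : ℤ)

/-- Averaging in direction `i`. -/
def avgG (G : Ed d → ℝ) (i : Fin d) (z : Ed d) : ℝ :=
  LL (fun k => G (z + (xs i k, 0)) - G (0 + (xs i k, 0)))

lemma avg_super {μ μ₀ : Zd d → ℝ} (hμ : ∀ z, 0 ≤ μ z) (hμ₀ : ∀ z, 0 ≤ μ₀ z) (h1 : H1 μ μ₀)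
    {t : ℝ} {G : Ed d → ℝ} (hG : Super μ μ₀ t G) (i : Fin d) : Super μ μ₀ t (avgG G i) := by
  intro z F
  have hb := fun z z' => harnack_bdd hμ hμ₀ h1 hG z z' (xs i)
  have hdiff : ∀ z', avgG G i z' - avgG G i z
      = LL (fun k => G (z' + (xs i k, 0)) - G (z + (xs i k, 0))) := by
    intro z'
    have := LL_add (hb 0 z) (hb z z')
    unfold avgG
    rw [sub_eq_iff_eq_add, add_comm, ← this]
    congr 1; funext k; ring
  set s : Ed d → ℝ := fun z' => avgG G i z' - avgG G i z with hs
  set c : Ed d → ℝ := fun z' => ker μ μ₀ z z' * Real.exp (s z') with hc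
  change ∑ z' ∈ F, c z' ≤ t
  have hsum := LL_sum F c (fun z' k => G (z' + (xs i k, 0)) - G (z + (xs i k, 0))) (fun z' => hb z z')
  have hle := LL_le (c := t - ∑ z' ∈ F, c z' * (1 - s z')) hsum.1 (fun k => by
    have h := hG (z + (xs i k, 0)) (F.map (addRightEmbedding ((xs i k, 0) : Ed d)))
    rw [Finset.sum_map] at h
    simp only [addRightEmbedding_apply, ker_tr] at h
    rw [le_sub_iff_add_le, ← Finset.sum_add_distrib]
    refine le_trans (Finset.sum_le_sum fun z' _ => ?_) h
    set D := G (z' + (xs i k, 0)) - G (z + (xs i k, 0)) with hD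
    have e : Real.exp D = Real.exp (s z') * Real.exp (D - s z') := by
      rw [← Real.exp_add]; ring_nf
    have h3 : c z' * D + c z' * (1 - s z') = ker μ μ₀ z z' * (Real.exp (s z') * (D - s z' + 1)) := by
      simp only [hc]; ring
    rw [h3, e]
    exact mul_le_mul_of_nonneg_left (mul_le_mul_of_nonneg_left (Real.add_one_le_exp _)
      (Real.exp_pos _).le) (ker_nonneg hμ hμ₀ _ _))
  rw [hsum.2] at hle
  have e2 : ∑ z' ∈ F, c z' * LL (fun k => G (z' + (xs i k, 0)) - G (z + (xs i k, 0)))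
      = ∑ z' ∈ F, c z' * s z' := Finset.sum_congr rfl fun z' _ => by rw [hs, ← hdiff]
  rw [e2, le_sub_iff_add_le, ← Finset.sum_add_distrib] at hle
  refine le_trans (le_of_eq ?_) hle
  refine Finset.sum_congr rfl fun z' _ => ?_
  ring

lemma avg_pres {μ μ₀ : Zd d → ℝ} (hμ : ∀ z, 0 ≤ μ z) (hμ₀ : ∀ z, 0 ≤ μ₀ z) (h1 : H1 μ μ₀)
    {t : ℝ} {G : Ed d → ℝ} (hG : Super μ μ₀ t G) (i j : Fin d) (r : ℝ)
    (hr : ∀ z, G (z + (Pi.single j 1, 0)) = G z + r) (z : Ed d) :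
    avgG G i (z + (Pi.single j 1, 0)) = avgG G i z + r := by
  unfold avgG
  rw [← LL_const r]
  have := LL_add (harnack_bdd hμ hμ₀ h1 hG 0 z (xs i)) (bdd_const r)
  rw [LL_const r] at this ⊢
  rw [← this]
  congr 1; funext k
  rw [add_right_comm, hr]; ring

lemma avg_new {μ μ₀ : Zd d → ℝ} (hμ : ∀ z, 0 ≤ μ z) (hμ₀ : ∀ z, 0 ≤ μ₀ z) (h1 : H1 μ μ₀)
    {t : ℝ} {G : Ed d → ℝ} (hG : Super μ μ₀ t G) (i : Fin d) :
    ∃ r, ∀ z, avgG G i (z + (Pi.single i 1, 0)) = avgG G i z + r := by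
  have hs : ∀ k, ((xs i (k+1), 0) : Ed d) = (Pi.single i 1, 0) + (xs i k, 0) := by
    intro k
    simp only [xs, Prod.mk_add_mk, ← Pi.single_add]
    simp [add_comm]
  refine ⟨LL (fun k => G ((Pi.single i 1, 0) + (xs i k, 0)) - G (0 + (xs i k, 0))), fun z => ?_⟩
  unfold avgG
  have hb := harnack_bdd hμ hμ₀ h1 hG 0 z (xs i)
  rw [← LL_succ hb]
  have hb' : Bdd (fun n => G (z + (xs i (n+1), 0)) - G (0 + (xs i (n+1), 0))) :=
    harnack_bdd hμ hμ₀ h1 hG 0 z (fun n => xs i (n+1))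
  rw [← LL_add hb' (harnack_bdd hμ hμ₀ h1 hG 0 _ (xs i))]
  congr 1; funext k
  rw [hs k, zero_add, zero_add, add_assoc]; ring

lemma exists_mult {μ μ₀ : Zd d → ℝ} (hμ : ∀ z, 0 ≤ μ z) (hμ₀ : ∀ z, 0 ≤ μ₀ z) (h1 : H1 μ μ₀)
    {t : ℝ} {G : Ed d → ℝ} (hG : Super μ μ₀ t G) (S : Finset (Fin d)) :
    ∃ G', Super μ μ₀ t G' ∧ ∀ i ∈ S, ∃ r, ∀ z, G' (z + (Pi.single i 1, 0)) = G' z + r := by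
  induction S using Finset.induction_on with
  | empty => exact ⟨G, hG, by simp⟩
  | insert a s ha ih =>
    obtain ⟨G', hG', hr⟩ := ih
    refine ⟨avgG G' a, avg_super hμ hμ₀ h1 hG' a, fun i hi => ?_⟩
    rcases Finset.mem_insert.mp hi with rfl | hi
    · exact avg_new hμ hμ₀ h1 hG' i
    · obtain ⟨r, hr⟩ := hr i hi
      exact ⟨r, avg_pres hμ hμ₀ h1 hG' a i r hr⟩

lemma mult_form {G : Ed d → ℝ} {α : Fin d → ℝ}
    (h : ∀ i z, G (z + (Pi.single i 1, 0)) = G z + α i) (x : Fin d → ℤ) (y : ℕ) :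
    G (x, y) = (∑ i, α i * (x i : ℝ)) + G (0, y) := by
  have hZ : ∀ i (k : ℤ) (x : Fin d → ℤ), G (x + Pi.single i k, y) = G (x, y) + α i * k := by
    intro i k
    induction k using Int.induction_on with
    | zero => intro x; simp
    | succ k ih =>
      intro x
      have := h i (x + Pi.single i (k:ℤ), y)
      rw [Prod.mk_add_mk, add_assoc, ← Pi.single_add, add_zero, ih] at this
      rw [this]; push_cast; ring
    | pred k ih =>
      intro x
      have := h i (x + Pi.single i (-(k:ℤ) - 1), y)
      rw [Prod.mk_add_mk, add_assoc, ← Pi.single_add, add_zero, sub_add_cancel, ih] at this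
      push_cast at this ⊢; linarith
  have key : ∀ S : Finset (Fin d), G (∑ i ∈ S, Pi.single i (x i), y)
      = (∑ i ∈ S, α i * (x i : ℝ)) + G (0, y) := by
    intro S
    induction S using Finset.induction_on with
    | empty => simp
    | insert a s ha ih =>
      rw [Finset.sum_insert ha, Finset.sum_insert ha, add_comm, hZ, ih]; ring
  have := key Finset.univ
  rwa [Finset.univ_sum_single] at this

lemma ker_jump0 {μ μ₀ : Zd d → ℝ} (z : Zd d) (k : ℕ) (hk : (k:ℤ) = z.2) :
    ker μ μ₀ (0, 0) (z.1, k) = μ₀ z := by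
  have : jump ((0, 0) : Ed d) (z.1, k) = z := by ext <;> simp [jump, hk]
  simp [ker, this]

lemma ker_jump {μ μ₀ : Zd d → ℝ} (z : Zd d) (y k : ℕ) (hk : (k:ℤ) = y + 1 + z.2) :
    ker μ μ₀ (0, y + 1) (z.1, k) = μ z := by
  have : jump ((0, y + 1) : Ed d) (z.1, k) = z := by ext <;> simp [jump, hk]
  simp [ker, this]

lemma exists_point_of_super {μ μ₀ : Zd d → ℝ} (hμ : ∀ z, 0 ≤ μ z) (hμ₀ : ∀ z, 0 ≤ μ₀ z)
    (h0 : H0 μ μ₀) (h1 : H1 μ μ₀) (h2 : H2 μ) {t : ℝ} {G : Ed d → ℝ} (hG : Super μ μ₀ t G) :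
    ∃ a : Rd d, phi μ a ≤ t ∧ phi μ₀ a ≤ t := by
  obtain ⟨G, hG, hr⟩ := exists_mult hμ hμ₀ h1 hG Finset.univ
  choose α hα using fun i => hr i (Finset.mem_univ i)
  have hform := mult_form hα
  set g : ℕ → ℝ := fun y => G (0, y) with hg
  obtain ⟨w, hw, hw2⟩ := exists_pos_dir hμ h2 (0, -1) (0, -1) (by rw [dotZ_last]; norm_num)
  have hw3 : w.2 = -1 := by
    have h3 : ¬ w.2 < -1 := fun h => hw.ne' (h0.1 w h)
    have h4 : (0:ℝ) < -(w.2:ℝ) := by simpa [dotZ] using hw2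
    have h5 : w.2 < 0 := by
      have : (w.2:ℝ) < 0 := by linarith
      exact_mod_cast this
    omega
  -- lower bound on increments
  have hlow : ∀ y, (∑ i, α i * (w.1 i : ℝ)) - Real.log (t / μ w) ≤ g (y+1) - g y := by
    intro y
    have h := hG (0, y+1) {(w.1, y)}
    rw [Finset.sum_singleton, ker_jump w y y (by rw [hw3]; ring), hform w.1 y] at h
    have h1 : Real.exp ((∑ i, α i * (w.1 i : ℝ)) + g y - g (y+1)) ≤ t / μ w := by
      rw [le_div_iff₀ hw, mul_comm]; exact h
    have h2 := Real.log_le_log (Real.exp_pos _) h1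
    rw [Real.log_exp] at h2
    linarith
  have hbb : BddBelow (Set.range fun y => g (y+1) - g y) := by
    refine ⟨(∑ i, α i * (w.1 i : ℝ)) - Real.log (t / μ w), ?_⟩
    rintro _ ⟨y, rfl⟩; exact hlow y
  set β : ℝ := ⨅ y, (g (y+1) - g y) with hβ
  have hβle : ∀ y, β ≤ g (y+1) - g y := fun y => ciInf_le hbb y
  have hmono : ∀ k y : ℕ, g y + k * β ≤ g (y + k) := by
    intro k
    induction k with
    | zero => intro y; simp
    | succ k ih =>
      intro y
      have := ih y
      have h2 := hβle (y + k)
      rw [← add_assoc]; push_cast; linarith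
  refine ⟨(α, β), ?_, ?_⟩
  · refine Real.tsum_le_of_sum_le (fun z => mul_nonneg (hμ z) (Real.exp_pos _).le) fun F => ?_
    set Sm := ∑ z ∈ F, μ z * Real.exp (dotZ (α, β) z) with hSm
    have key : ∀ y, Sm * Real.exp (β - (g (y+1) - g y)) ≤ t := by
      intro y
      have h := hG (0, y+1) ((F.filter fun z => -1 ≤ z.2).image
        (fun z => ((z.1, ((y:ℤ) + 1 + z.2).toNat) : Ed d)))
      rw [Finset.sum_image] at h
      · refine le_trans ?_ h
        have e : Sm = ∑ z ∈ F.filter (fun z => -1 ≤ z.2), μ z * Real.exp (dotZ (α, β) z) := by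
          symm
          rw [hSm]
          refine Finset.sum_subset (Finset.filter_subset _ _) fun z hz hz' => ?_
          rw [h0.1 z (by simpa [hz] using hz'), zero_mul]
        rw [e, Finset.sum_mul]
        refine Finset.sum_le_sum fun z hz => ?_
        have hz2 : -1 ≤ z.2 := (Finset.mem_filter.mp hz).2
        obtain ⟨k, hk⟩ := Int.eq_ofNat_of_zero_le (show 0 ≤ z.2 + 1 by omega)
        have hn : ((y:ℤ) + 1 + z.2).toNat = y + k := by omega
        rw [hn, ker_jump z y (y + k) (by push_cast; omega), hform z.1 (y+k), mul_assoc, ← Real.exp_add]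
        refine mul_le_mul_of_nonneg_left (Real.exp_le_exp.mpr ?_) (hμ z)
        have h3 := hmono k y
        have hk' : (z.2:ℝ) = k - 1 := by
          have : z.2 = (k:ℤ) - 1 := by omega
          rw [this]; push_cast; ring
        simp only [dotZ, hk']
        simp only [hg] at h3 ⊢
        linarith
      · intro z hz z' hz' he
        have hz2 : -1 ≤ z.2 := (Finset.mem_filter.mp hz).2
        have hz2' : -1 ≤ z'.2 := (Finset.mem_filter.mp hz').2
        simp only [Prod.mk.injEq] at he
        exact Prod.ext he.1 (by have := he.2; omega)
    have hSm0 : 0 ≤ Sm := Finset.sum_nonneg fun z _ => mul_nonneg (hμ z) (Real.exp_pos _).le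
    by_contra! hcon
    -- choose y with increments close to the infimum
    have hcont : Tendsto (fun e : ℝ => Sm * Real.exp (-e)) (nhds 0) (nhds (Sm * Real.exp (-0))) := by
      apply Continuous.tendsto; fun_prop
    rw [neg_zero, Real.exp_zero, mul_one] at hcont
    have hev := hcont.eventually (lt_mem_nhds hcon)
    obtain ⟨ε, hε, hball⟩ := Metric.eventually_nhds_iff.mp hev
    obtain ⟨y, hy⟩ := exists_lt_of_ciInf_lt (show ⨅ y, (g (y+1) - g y) < β + ε by
      rw [← hβ]; linarith)
    have h5 := hball (y := g (y+1) - g y - β) (by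
      rw [Real.dist_eq, sub_zero, abs_of_nonneg (by linarith [hβle y])]; linarith)
    rw [neg_sub] at h5
    linarith [key y]
  · refine Real.tsum_le_of_sum_le (fun z => mul_nonneg (hμ₀ z) (Real.exp_pos _).le) fun F => ?_
    have h := hG (0, 0) ((F.filter fun z => 0 ≤ z.2).image (fun z => ((z.1, z.2.toNat) : Ed d)))
    rw [Finset.sum_image] at h
    · refine le_trans ?_ h
      have e : ∑ z ∈ F, μ₀ z * Real.exp (dotZ (α, β) z)
          = ∑ z ∈ F.filter (fun z => 0 ≤ z.2), μ₀ z * Real.exp (dotZ (α, β) z) := by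
        symm
        refine Finset.sum_subset (Finset.filter_subset _ _) fun z hz hz' => ?_
        rw [h0.2 z (by simpa [hz] using hz'), zero_mul]
      rw [e]
      refine Finset.sum_le_sum fun z hz => ?_
      have hz2 : 0 ≤ z.2 := (Finset.mem_filter.mp hz).2
      obtain ⟨k, hk⟩ := Int.eq_ofNat_of_zero_le hz2
      have hn : z.2.toNat = k := by omega
      rw [hn, ker_jump0 z k hk.symm, hform z.1 k]
      refine mul_le_mul_of_nonneg_left (Real.exp_le_exp.mpr ?_) (hμ₀ z)
      have h3 := hmono k 0
      rw [zero_add] at h3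
      have hk' : (z.2:ℝ) = k := by rw [hk]; push_cast; rfl
      simp only [dotZ, hk']
      simp only [hg] at h3 ⊢
      linarith
    · intro z hz z' hz' he
      have hz2 : 0 ≤ z.2 := (Finset.mem_filter.mp hz).2
      have hz2' : 0 ≤ z'.2 := (Finset.mem_filter.mp hz').2
      simp only [Prod.mk.injEq] at he
      exact Prod.ext he.1 (by have := he.2; omega)

open scoped ENNReal in
/-- The kernel with values in `[0,∞]`. -/
def KE (μ μ₀ : Zd d → ℝ) (z z' : Ed d) : ℝ≥0∞ := ENNReal.ofReal (ker μ μ₀ z z')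

open scoped ENNReal in
/-- The iterated kernel with values in `[0,∞]`. -/
def QN (μ μ₀ : Zd d → ℝ) : ℕ → Ed d → Ed d → ℝ≥0∞
  | 0 => fun z z' => if z = z' then 1 else 0
  | n + 1 => fun z z' => ∑' w, QN μ μ₀ n z w * KE μ μ₀ w z'

lemma QN_succ (μ μ₀ : Zd d → ℝ) (n : ℕ) (z z' : Ed d) :
    QN μ μ₀ (n+1) z z' = ∑' w, QN μ μ₀ n z w * KE μ μ₀ w z' := rfl

lemma jump_inj (z : Ed d) : Function.Injective (jump z) := by
  intro w w' h
  simp only [jump, Prod.mk.injEq, sub_left_inj] at h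
  exact Prod.ext h.1 (by have := h.2; omega)

lemma tsum_ofReal_le_one {μ : Zd d → ℝ} (hμ : IsMeasure μ) :
    ∑' z, ENNReal.ofReal (μ z) ≤ 1 := by
  have hs : Summable μ := by
    by_contra h
    have := hμ.2.1
    rw [tsum_eq_zero_of_not_summable h] at this
    exact lt_irrefl _ this
  rw [← ENNReal.ofReal_tsum_of_nonneg hμ.1 hs]
  exact ENNReal.ofReal_le_one.mpr hμ.2.2

lemma KE_sum {μ μ₀ : Zd d → ℝ} (hμ : IsMeasure μ) (hμ₀ : IsMeasure μ₀) (z : Ed d) :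
    ∑' z', KE μ μ₀ z z' ≤ 1 := by
  unfold KE ker
  split_ifs with h
  · exact (ENNReal.tsum_comp_le_tsum_of_injective (jump_inj z)
      (fun z => ENNReal.ofReal (μ₀ z))).trans (tsum_ofReal_le_one hμ₀)
  · exact (ENNReal.tsum_comp_le_tsum_of_injective (jump_inj z)
      (fun z => ENNReal.ofReal (μ z))).trans (tsum_ofReal_le_one hμ)

lemma QN_sum {μ μ₀ : Zd d → ℝ} (hμ : IsMeasure μ) (hμ₀ : IsMeasure μ₀) (n : ℕ) (z : Ed d) :
    ∑' z', QN μ μ₀ n z z' ≤ 1 := by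
  induction n with
  | zero =>
    simp only [QN]
    rw [tsum_ite_eq']
  | succ n ih =>
    simp only [QN_succ]
    rw [ENNReal.tsum_comm]
    simp only [ENNReal.tsum_mul_left]
    refine le_trans (ENNReal.tsum_le_tsum fun w => ?_) ih
    exact mul_le_of_le_one_right zero_le (KE_sum hμ hμ₀ w)

lemma QN_le_one {μ μ₀ : Zd d → ℝ} (hμ : IsMeasure μ) (hμ₀ : IsMeasure μ₀) (n : ℕ) (z z' : Ed d) :
    QN μ μ₀ n z z' ≤ 1 := (ENNReal.le_tsum z').trans (QN_sum hμ hμ₀ n z)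

lemma QN_ne_top {μ μ₀ : Zd d → ℝ} (hμ : IsMeasure μ) (hμ₀ : IsMeasure μ₀) (n : ℕ) (z z' : Ed d) :
    QN μ μ₀ n z z' ≠ ⊤ := ne_top_of_le_ne_top ENNReal.one_ne_top (QN_le_one hμ hμ₀ n z z')

lemma kerN_eq {μ μ₀ : Zd d → ℝ} (hμ : IsMeasure μ) (hμ₀ : IsMeasure μ₀) (n : ℕ) :
    ∀ z z' : Ed d, kerN μ μ₀ n z z' = (QN μ μ₀ n z z').toReal := by
  induction n with
  | zero => intro z z'; simp only [kerN, QN]; split_ifs <;> simp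
  | succ n ih =>
    intro z z'
    simp only [kerN, QN_succ]
    rw [ENNReal.tsum_toReal_eq]
    · refine tsum_congr fun w => ?_
      rw [ENNReal.toReal_mul, ← ih, KE, ENNReal.toReal_ofReal (ker_nonneg hμ.1 hμ₀.1 _ _)]
    · intro w
      exact ENNReal.mul_ne_top (QN_ne_top hμ hμ₀ _ _ _) ENNReal.ofReal_ne_top

lemma kerN_le_one {μ μ₀ : Zd d → ℝ} (hμ : IsMeasure μ) (hμ₀ : IsMeasure μ₀) (n : ℕ)
    (z z' : Ed d) : kerN μ μ₀ n z z' ≤ 1 := by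
  rw [kerN_eq hμ hμ₀]
  exact ENNReal.toReal_le_of_le_ofReal zero_le_one (by simpa using QN_le_one hμ hμ₀ n z z')

lemma QN_succ' (μ μ₀ : Zd d → ℝ) (n : ℕ) : ∀ z z' : Ed d,
    QN μ μ₀ (n+1) z z' = ∑' w, KE μ μ₀ z w * QN μ μ₀ n w z' := by
  induction n with
  | zero =>
    intro z z'
    simp only [QN, ite_mul, one_mul, zero_mul, mul_ite, mul_one, mul_zero]
    rw [tsum_ite_eq' z, tsum_ite_eq z']
  | succ n ih =>
    intro z z'
    rw [QN_succ]
    simp only [ih, ← ENNReal.tsum_mul_right]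
    rw [ENNReal.tsum_comm]
    refine tsum_congr fun v => ?_
    rw [← ih, QN_succ, ← ENNReal.tsum_mul_left]
    refine tsum_congr fun w => ?_
    rw [mul_assoc]

lemma QN_CK (μ μ₀ : Zd d → ℝ) (m n : ℕ) (z w : Ed d) : ∀ z',
    QN μ μ₀ m z w * QN μ μ₀ n w z' ≤ QN μ μ₀ (m + n) z z' := by
  induction n with
  | zero =>
    intro z'
    simp only [QN, add_zero]
    split_ifs with h
    · subst h; simp
    · simp
  | succ n ih =>
    intro z'
    rw [← add_assoc, QN_succ, QN_succ, ← ENNReal.tsum_mul_left]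
    refine ENNReal.tsum_le_tsum fun v => ?_
    rw [← mul_assoc]
    exact mul_le_mul_left (ih v) _

open scoped ENNReal in
/-- The Green function with values in `[0,∞]`. -/
def GE (μ μ₀ : Zd d → ℝ) (t : ℝ) (z : Ed d) : ℝ≥0∞ :=
  ∑' n, (ENNReal.ofReal t⁻¹) ^ n * QN μ μ₀ n z 0

lemma exists_super {μ μ₀ : Zd d → ℝ} (hμ : IsMeasure μ) (hμ₀ : IsMeasure μ₀) (h1 : H1 μ μ₀)
    {t : ℝ} (ht : rho μ μ₀ < t) : ∃ G, Super μ μ₀ t G := by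
  have hnn := fun n => kerN_nonneg hμ.1 hμ₀.1 n 0 0
  obtain ⟨s, hs1, hs2⟩ := exists_between ht
  have hbdd : IsBoundedUnder (· ≤ ·) atTop
      (fun n : ℕ => (kerN μ μ₀ n 0 0) ^ ((n : ℝ)⁻¹)) :=
    isBoundedUnder_of ⟨1, fun n => Real.rpow_le_one (hnn n) (kerN_le_one hμ hμ₀ n 0 0)
      (by positivity)⟩
  have hev := eventually_lt_of_limsup_lt hs1 hbdd
  have hs0 : 0 < s := by
    obtain ⟨n, hn⟩ := hev.exists
    exact lt_of_le_of_lt (Real.rpow_nonneg (hnn n) _) hn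
  have ht0 : 0 < t := hs0.trans hs2
  have hsumm : Summable fun n => (t⁻¹) ^ n * kerN μ μ₀ n 0 0 := by
    have hgeo : Summable fun n : ℕ => (s / t) ^ n :=
      summable_geometric_of_lt_one (by positivity) ((div_lt_one ht0).mpr hs2)
    refine Summable.of_norm_bounded_eventually_nat hgeo ?_
    filter_upwards [hev, eventually_gt_atTop 0] with n hn hn0
    rw [Real.norm_of_nonneg (mul_nonneg (by positivity) (hnn n)), div_eq_inv_mul, mul_pow]
    refine mul_le_mul_of_nonneg_left ?_ (by positivity)
    have h := pow_le_pow_left₀ (Real.rpow_nonneg (hnn n) _) hn.le n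
    rwa [Real.rpow_inv_natCast_pow (hnn n) hn0.ne'] at h
  have hG0 : GE μ μ₀ t 0 ≠ ⊤ := by
    have := hsumm.tsum_ofReal_ne_top
    convert this using 1
    unfold GE
    refine tsum_congr fun n => ?_
    rw [ENNReal.ofReal_mul (by positivity), ENNReal.ofReal_pow (by positivity), kerN_eq hμ hμ₀,
      ENNReal.ofReal_toReal (QN_ne_top hμ hμ₀ _ _ _)]
  have hT0 : ENNReal.ofReal t⁻¹ ≠ 0 := by
    simpa using ht0
  have hQpos : ∀ z z', ∃ n, QN μ μ₀ n z z' ≠ 0 := by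
    intro z z'
    obtain ⟨n, hn⟩ := h1 z z'
    refine ⟨n, fun h => ?_⟩
    rw [kerN_eq hμ hμ₀, h] at hn
    simp at hn
  have hGtop : ∀ z, GE μ μ₀ t z ≠ ⊤ := by
    intro z hz
    obtain ⟨m, hm⟩ := hQpos 0 z
    have hle : (ENNReal.ofReal t⁻¹) ^ m * QN μ μ₀ m 0 z * GE μ μ₀ t z ≤ GE μ μ₀ t 0 := by
      unfold GE
      rw [← ENNReal.tsum_mul_left]
      refine le_trans (ENNReal.tsum_le_tsum fun n => ?_) (ENNReal.tsum_comp_le_tsum_of_injective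
        (add_right_injective m) (fun n => (ENNReal.ofReal t⁻¹) ^ n * QN μ μ₀ n 0 0))
      calc (ENNReal.ofReal t⁻¹) ^ m * QN μ μ₀ m 0 z * ((ENNReal.ofReal t⁻¹) ^ n * QN μ μ₀ n z 0)
          = (ENNReal.ofReal t⁻¹) ^ (m + n) * (QN μ μ₀ m 0 z * QN μ μ₀ n z 0) := by
            rw [pow_add]; ring
        _ ≤ _ := mul_le_mul_right (QN_CK μ μ₀ m n 0 z 0) _
    rw [hz, ENNReal.mul_top (mul_ne_zero (pow_ne_zero _ hT0) hm)] at hle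
    exact hG0 (top_le_iff.mp hle)
  have hGpos : ∀ z, GE μ μ₀ t z ≠ 0 := by
    intro z hz
    obtain ⟨m, hm⟩ := hQpos z 0
    unfold GE at hz
    rw [ENNReal.tsum_eq_zero] at hz
    exact (mul_ne_zero (pow_ne_zero _ hT0) hm) (hz m)
  have hsup : ∀ z, ENNReal.ofReal t⁻¹ * ∑' w, KE μ μ₀ z w * GE μ μ₀ t w ≤ GE μ μ₀ t z := by
    intro z
    have e : ENNReal.ofReal t⁻¹ * ∑' w, KE μ μ₀ z w * GE μ μ₀ t w
        = ∑' n, (ENNReal.ofReal t⁻¹) ^ (n+1) * QN μ μ₀ (n+1) z 0 := by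
      unfold GE
      simp only [← ENNReal.tsum_mul_left]
      rw [ENNReal.tsum_comm]
      refine tsum_congr fun n => ?_
      rw [QN_succ', ← ENNReal.tsum_mul_left]
      refine tsum_congr fun w => ?_
      rw [pow_succ]; ring
    rw [e]
    exact ENNReal.tsum_comp_le_tsum_of_injective
        (add_left_injective 1) (fun n => (ENNReal.ofReal t⁻¹) ^ n * QN μ μ₀ n z 0)
  have hpos : ∀ z, 0 < (GE μ μ₀ t z).toReal := fun z => ENNReal.toReal_pos (hGpos z) (hGtop z)
  refine ⟨fun z => Real.log (GE μ μ₀ t z).toReal, fun z F => ?_⟩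
  have h := le_trans (mul_le_mul_right (ENNReal.sum_le_tsum F) _) (hsup z)
  have h' := ENNReal.toReal_mono (hGtop z) h
  rw [ENNReal.toReal_mul, ENNReal.toReal_sum (fun w _ => ENNReal.mul_ne_top (by simp [KE]) (hGtop w)), ENNReal.toReal_ofReal (by positivity)] at h'
  simp only [ENNReal.toReal_mul, KE, ENNReal.toReal_ofReal (ker_nonneg hμ.1 hμ₀.1 _ _)] at h'
  rw [inv_mul_le_iff₀ ht0] at h'
  have e : ∀ w, ker μ μ₀ z w * Real.exp (Real.log (GE μ μ₀ t w).toReal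
      - Real.log (GE μ μ₀ t z).toReal)
      = ker μ μ₀ z w * (GE μ μ₀ t w).toReal / (GE μ μ₀ t z).toReal := by
    intro w
    rw [Real.exp_sub, Real.exp_log (hpos w), Real.exp_log (hpos z), mul_div_assoc]
  simp only [e]
  rw [← Finset.sum_div, div_le_iff₀ (hpos z)]
  exact h'

lemma dotR_add (q a b : Rd d) : dotR q (a + b) = dotR q a + dotR q b := by
  simp [dotR, mul_add, Finset.sum_add_distrib]; ring

lemma dotR_smul (q : Rd d) (c : ℝ) (a : Rd d) : dotR q (c • a) = c * dotR q a := by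
  simp only [dotR, Prod.smul_fst, Prod.smul_snd, Pi.smul_apply, smul_eq_mul, mul_add,
    Finset.mul_sum]
  congr 1
  · exact Finset.sum_congr rfl fun i _ => by ring
  · ring

lemma dotR_sub (q a b : Rd d) : dotR q (a - b) = dotR q a - dotR q b := by
  simp [dotR, mul_sub, Finset.sum_sub_distrib]; ring

lemma phi_hasDerivAt {μ : Zd d → ℝ} (hμ : ∀ z, 0 ≤ μ z) (h3 : H3 μ) (α : Fin d → ℝ) (β : ℝ) :
    HasDerivAt (fun y : ℝ => phi μ (α, y)) (dBeta (phi μ) (α, β)) β := by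
  have h1 := ((phi_diff hμ h3) (α, β)).hasFDerivAt
  have h2 : HasDerivAt (fun y : ℝ => ((α, y) : Rd d)) (0, 1) β :=
    (hasDerivAt_const β α).prodMk (hasDerivAt_id β)
  exact h1.comp_hasDerivAt β h2

lemma exists_up {μ μ₀ : Zd d → ℝ} (hμ : ∀ z, 0 ≤ μ z) (hμ₀ : ∀ z, 0 ≤ μ₀ z) (h1 : H1 μ μ₀) :
    ∃ z, 0 < μ₀ z ∧ 0 < z.2 := by
  by_contra! hcon
  have := ker_induction hμ hμ₀ h1 0 (fun w => w.2 = 0) rfl (fun w w' hw hk => by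
    simp only [ker, hw, if_true] at hk
    have := hcon _ hk
    simp only [jump, hw] at this
    omega) (0, 1)
  simp at this

lemma phi0_strict {μ μ₀ : Zd d → ℝ} (hμ : ∀ z, 0 ≤ μ z) (hμ₀ : ∀ z, 0 ≤ μ₀ z) (h0 : H0 μ μ₀)
    (h1 : H1 μ μ₀) (h3' : H3 μ₀) (α : Fin d → ℝ) (β ε : ℝ) (hε : 0 < ε) :
    phi μ₀ (α, β - ε) < phi μ₀ (α, β) := by
  obtain ⟨w, hw, hw2⟩ := exists_up hμ hμ₀ h1
  refine Summable.tsum_lt_tsum (i := w) (fun z => ?_) ?_ (h3' _) (h3' _)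
  · by_cases hz : z.2 < 0
    · simp [h0.2 z hz]
    · refine mul_le_mul_of_nonneg_left (Real.exp_le_exp.mpr ?_) (hμ₀ z)
      have : (0:ℝ) ≤ z.2 := by exact_mod_cast not_lt.mp hz
      simp only [dotZ]
      nlinarith
  · refine mul_lt_mul_of_pos_left (Real.exp_lt_exp.mpr ?_) hw
    have : (0:ℝ) < w.2 := by exact_mod_cast hw2
    simp only [dotZ]
    nlinarith

lemma mem_theta_iff {μ μ₀ : Zd d → ℝ} (hμ : ∀ z, 0 ≤ μ z) (hμ₀ : ∀ z, 0 ≤ μ₀ z)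
    (h2 : H2 μ) (h3 : H3 μ) (h3' : H3 μ₀) {t : ℝ} (α : Fin d → ℝ) :
    α ∈ Theta μ μ₀ t ↔ ∃ β, phi μ (α, β) ≤ t ∧ phi μ₀ (α, β) ≤ t := by
  have hc := phi_cont hμ h3
  have hc₀ := phi_cont hμ₀ h3'
  have hnn : ∀ a, 0 ≤ phi μ a := fun a => tsum_nonneg fun z => mul_nonneg (hμ z) (Real.exp_pos _).le
  have hbb : BddBelow (Set.range fun β : ℝ => max (phi μ (α, β)) (phi μ₀ (α, β))) := by
    refine ⟨0, ?_⟩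
    rintro _ ⟨β, rfl⟩
    exact (hnn _).trans (le_max_left _ _)
  constructor
  · intro h
    have h' : sInf (Set.range fun β : ℝ => max (phi μ (α, β)) (phi μ₀ (α, β))) ≤ t := h
    set f : ℝ → ℝ := fun β => max (phi μ (α, β)) (phi μ₀ (α, β)) with hf
    have hfc : Continuous f := by fun_prop
    -- the compact set where `f ≤ t + 1`
    have hK : IsCompact {b : ℝ | f b ≤ t + 1} := by
      refine ((dset_compact hμ h2 h3 (t+1)).image continuous_snd).of_isClosed_subset
        (isClosed_le hfc continuous_const) fun b hb => ?_
      exact ⟨(α, b), show phi μ (α, b) ≤ t + 1 from (le_max_left _ _).trans hb, rfl⟩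
    obtain ⟨_, ⟨b0, rfl⟩, hb0⟩ := exists_lt_of_csInf_lt (Set.range_nonempty f)
      (lt_of_le_of_lt h' (lt_add_one t))
    obtain ⟨b, hb, hmin⟩ := hK.exists_isMinOn ⟨b0, hb0.le⟩ hfc.continuousOn
    have hall : ∀ x, f b ≤ f x := by
      intro x
      by_cases hx : f x ≤ t + 1
      · exact hmin hx
      · exact (show f b ≤ t + 1 from hb).trans (not_le.mp hx).le
    have : f b ≤ t := (le_csInf (Set.range_nonempty f) (by rintro _ ⟨x, rfl⟩; exact hall x)).trans h'
    exact ⟨b, (le_max_left _ _).trans this, (le_max_right _ _).trans this⟩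
  · rintro ⟨β, hβ, hβ0⟩
    exact (csInf_le hbb ⟨β, rfl⟩).trans (max_le hβ hβ0)

lemma hhat_compact {μ μ₀ : Zd d → ℝ} (hμ : ∀ z, 0 ≤ μ z) (hμ₀ : ∀ z, 0 ≤ μ₀ z)
    (h2 : H2 μ) (h3 : H3 μ) (h3' : H3 μ₀) (t : ℝ) : IsCompact (Hhat μ μ₀ t) := by
  have hTh : Theta μ μ₀ t = Prod.fst '' (Dset μ t ∩ {a | phi μ₀ a ≤ t}) := by
    ext α
    rw [mem_theta_iff hμ hμ₀ h2 h3 h3']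
    constructor
    · rintro ⟨β, h4, h5⟩; exact ⟨(α, β), ⟨h4, h5⟩, rfl⟩
    · rintro ⟨⟨x, y⟩, ⟨h4, h5⟩, rfl⟩; exact ⟨y, h4, h5⟩
  have hcl : IsClosed (Theta μ μ₀ t) := by
    rw [hTh]
    exact (((dset_compact hμ h2 h3 t).inter_right
      (isClosed_le (phi_cont hμ₀ h3') continuous_const)).image continuous_fst).isClosed
  have : Hhat μ μ₀ t = Dset μ t ∩ (Prod.fst ⁻¹' Theta μ μ₀ t) := by
    ext a; exact and_comm
  rw [this]
  exact (dset_compact hμ h2 h3 t).inter_right (hcl.preimage continuous_fst)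

/-- Theorem 1 (i): under (H0)-(H4), for every `t > ρ(P)` and every
unit vector `q ∈ ℝ^{d-1} × [0,∞)` there is a unique `a ∈ Γ₊^t` with `q ∈ V_t(a)`. -/
theorem exists_unique_normal_cone_point {d : ℕ} (μ μ₀ : Zd d → ℝ)
    (hμ : IsMeasure μ) (hμ₀ : IsMeasure μ₀)
    (h0 : H0 μ μ₀) (h1 : H1 μ μ₀) (h2 : H2 μ) (h3 : H3 μ) (h3' : H3 μ₀) (h4 : H4 μ)
    (t : ℝ) (ht : rho μ μ₀ < t)
    (q : Rd d) (hq : euclNorm q = 1) (hq2 : 0 ≤ q.2) :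
    ∃! a : Rd d, a ∈ GammaPlus μ μ₀ t ∧ q ∈ Vcone μ μ₀ t a := by
  obtain ⟨G, hG⟩ := exists_super hμ hμ₀ h1 ht
  obtain ⟨p, hp, hp0⟩ := exists_point_of_super hμ.1 hμ₀.1 h0 h1 h2 hG
  have hc := phi_cont hμ.1 h3
  have hc₀ := phi_cont hμ₀.1 h3'
  have hTh := mem_theta_iff hμ.1 hμ₀.1 h2 h3 h3' (t := t)
  have hHc := hhat_compact hμ.1 hμ₀.1 h2 h3 h3' t
  have hqc : Continuous (dotR q) := by unfold dotR; fun_prop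
  have hq0 : q.2 = 0 → 0 < ∑ i, q.1 i * q.1 i := by
    intro h
    by_contra! hcon
    unfold euclNorm at hq
    rw [h] at hq
    simp only [← pow_two] at hcon
    rw [Real.sqrt_eq_zero_of_nonpos (by simpa using hcon)] at hq
    exact zero_ne_one hq
  have hphi_t : ∀ a ∈ dPlus μ t, phi μ a = t := by
    intro a ha
    have hcl : IsClosed (Dset μ t) := (dset_compact hμ.1 h2 h3 t).isClosed
    have h4 : a ∈ Dset μ t := hcl.frontier_subset ha.1
    by_contra hne
    have h5 : phi μ a < t := lt_of_le_of_ne h4 hne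
    have h6 : a ∈ interior (Dset μ t) :=
      mem_interior.mpr ⟨{b | phi μ b < t}, fun b hb => show phi μ b ≤ t from le_of_lt hb,
        isOpen_lt hc continuous_const, h5⟩
    exact ha.1.2 h6
  refine existsUnique_of_exists_of_unique ?_ ?_
  · obtain ⟨a0, ha0, hmax⟩ := hHc.exists_isMaxOn ⟨p, (hTh p.1).mpr ⟨p.2, hp, hp0⟩, hp⟩
      hqc.continuousOn
    have hfc : IsCompact {b : ℝ | phi μ (a0.1, b) ≤ t} := by
      have : {b : ℝ | phi μ (a0.1, b) ≤ t} = Prod.snd '' (Dset μ t ∩ {a | a.1 = a0.1}) := by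
        ext b
        constructor
        · intro hb; exact ⟨(a0.1, b), ⟨hb, rfl⟩, rfl⟩
        · rintro ⟨⟨x, y⟩, ⟨h4, h5⟩, rfl⟩
          replace h5 : x = a0.1 := h5
          subst h5; exact h4
      rw [this]
      exact ((dset_compact hμ.1 h2 h3 t).inter_right
        (isClosed_eq continuous_fst continuous_const)).image continuous_snd
    obtain ⟨b1, hb1, hb1max⟩ := hfc.exists_isGreatest ⟨a0.2, ha0.2⟩
    have habove : ∀ b, b1 < b → t < phi μ (a0.1, b) := by
      intro b hb
      by_contra! hcon
      exact absurd (hb1max hcon) (not_le.mpr hb)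
    refine ⟨(a0.1, b1), ⟨⟨ha0.1, hb1⟩, ⟨?_, ?_⟩⟩, ?_⟩
    · refine ⟨subset_closure hb1, fun hint => ?_⟩
      have hcur : Tendsto (fun b : ℝ => ((a0.1, b) : Rd d)) (nhds b1) (nhds (a0.1, b1)) :=
        Continuous.tendsto (by fun_prop) _
      have hev := hcur.eventually (mem_interior_iff_mem_nhds.mp hint)
      obtain ⟨ε, hε, hball⟩ := Metric.eventually_nhds_iff.mp hev
      have h5 : phi μ (a0.1, b1 + ε / 2) ≤ t := hball (y := b1 + ε / 2) (by
        rw [Real.dist_eq, add_sub_cancel_left, abs_of_pos (by linarith)]; linarith)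
      linarith [habove (b1 + ε / 2) (by linarith)]
    · have hd := phi_hasDerivAt hμ.1 h3 a0.1 b1
      rw [hasDerivAt_iff_tendsto_slope] at hd
      have hd' := hd.mono_left (nhdsWithin_mono b1
        (show Set.Ioi b1 ⊆ {b1}ᶜ from fun x hx => ne_of_gt hx))
      refine ge_of_tendsto hd' ?_
      filter_upwards [self_mem_nhdsWithin] with b hb
      have hb' : b1 < b := hb
      rw [slope_def_field]
      have h5 := habove b hb'
      have h6 : phi μ (a0.1, b1) ≤ t := hb1
      exact div_nonneg (by linarith) (by linarith)
    · intro a' ha'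
      have h5 : dotR q a' ≤ dotR q a0 := hmax ha'
      have h6 : a0.2 ≤ b1 := hb1max ha0.2
      have h7 := mul_le_mul_of_nonneg_left h6 hq2
      simp only [dotR_sub]
      simp only [dotR] at h5 ⊢
      linarith
  · rintro a b ⟨⟨haH, haP⟩, haV⟩ ⟨⟨hbH, hbP⟩, hbV⟩
    by_contra hab
    have hqab : dotR q a = dotR q b := by
      have h5 := haV b hbH
      have h6 := hbV a haH
      rw [dotR_sub] at h5 h6
      linarith
    have hVmax : ∀ c ∈ Hhat μ μ₀ t, dotR q c ≤ dotR q a := by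
      intro c hc
      have := haV c hc
      rw [dotR_sub] at this; linarith
    have hta := hphi_t a haP
    have htb := hphi_t b hbP
    have hmid := phi_mid_lt hμ.1 h2 h3 a b hab
    rw [hta, htb] at hmid
    obtain ⟨β, hβ, hβ0⟩ := (hTh _).mp haH.1
    obtain ⟨β', hβ', hβ0'⟩ := (hTh _).mp hbH.1
    -- the midpoint of the two lower points
    set c : Rd d := (1/2:ℝ) • (a.1, β) + (1/2:ℝ) • (b.1, β') with hcdef
    set m : Rd d := (1/2:ℝ) • a + (1/2:ℝ) • b with hmdef
    have hm1 : m.1 = c.1 := by simp [hmdef, hcdef]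
    have hcφ : phi μ c ≤ t := by
      have := (phi_convex hμ.1 h3).2 (Set.mem_univ (a.1, β)) (Set.mem_univ (b.1, β'))
        (show (0:ℝ) ≤ 1/2 by norm_num) (show (0:ℝ) ≤ 1/2 by norm_num) (by norm_num)
      simp only [smul_eq_mul] at this
      linarith
    have hcφ₀ : phi μ₀ c ≤ t := by
      have := (phi_convex hμ₀.1 h3').2 (Set.mem_univ (a.1, β)) (Set.mem_univ (b.1, β'))
        (show (0:ℝ) ≤ 1/2 by norm_num) (show (0:ℝ) ≤ 1/2 by norm_num) (by norm_num)
      simp only [smul_eq_mul] at this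
      linarith
    have hmTh : m.1 ∈ Theta μ μ₀ t := (hTh _).mpr ⟨c.2, by rw [hm1]; exact ⟨hcφ, hcφ₀⟩⟩
    have hqm : dotR q m = dotR q a := by
      rw [hmdef, dotR_add, dotR_smul, dotR_smul, ← hqab]; ring
    rcases hq2.lt_or_eq with hq2 | hq2
    · have hcur : Tendsto (fun e : ℝ => phi μ (m.1, m.2 + e)) (nhds 0)
          (nhds (phi μ (m.1, m.2 + 0))) := Continuous.tendsto (by fun_prop) _
      rw [add_zero] at hcur
      have hev := hcur.eventually (gt_mem_nhds (show phi μ (m.1, m.2) < t by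
        have : phi μ m < t := by linarith
        exact this))
      obtain ⟨ε, hε, hball⟩ := Metric.eventually_nhds_iff.mp hev
      have h5 := hball (y := ε / 2) (by
        rw [Real.dist_eq, sub_zero, abs_of_pos (by linarith)]; linarith)
      have h6 := hVmax (m.1, m.2 + ε / 2) ⟨hmTh, h5.le⟩
      rw [← hqm] at h6
      have h7 : 0 < q.2 * (ε / 2) := by positivity
      simp only [dotR] at h6
      linarith
    · by_cases h1ab : a.1 = b.1
      · have key : ∀ a b : Rd d, a ∈ dPlus μ t → b ∈ dPlus μ t → a.1 = b.1 → ¬ a.2 < b.2 := by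
          intro a b haP hbP h1ab hlt
          have hta := hphi_t a haP
          have htb := hphi_t b hbP
          have hne : a ≠ b := fun h => by rw [h] at hlt; exact lt_irrefl _ hlt
          have hmid := phi_mid_lt hμ.1 h2 h3 a b hne
          rw [hta, htb] at hmid
          have em : (1/2:ℝ) • a + (1/2:ℝ) • b = (a.1, (a.2 + b.2) / 2) := by
            ext i
            · simp [h1ab]; ring
            · simp; ring
          rw [em] at hmid
          have hcv : ConvexOn ℝ Set.univ (fun y : ℝ => phi μ (a.1, y)) := by
            refine ⟨convex_univ, fun x _ y _ s r hs hr hsr => ?_⟩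
            have := (phi_convex hμ.1 h3).2 (Set.mem_univ (a.1, x)) (Set.mem_univ (a.1, y)) hs hr hsr
            rwa [Prod.smul_mk, Prod.smul_mk, Prod.mk_add_mk, ← add_smul, hsr, one_smul] at this
          have hsl := hcv.le_slope_of_hasDerivAt (Set.mem_univ a.2)
            (Set.mem_univ ((a.2 + b.2) / 2)) (by linarith) (phi_hasDerivAt hμ.1 h3 a.1 a.2)
          rw [slope_def_field] at hsl
          have hneg : (phi μ (a.1, (a.2 + b.2) / 2) - phi μ (a.1, a.2)) / ((a.2 + b.2) / 2 - a.2) < 0 := by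
            apply div_neg_of_neg_of_pos
            · have : phi μ (a.1, a.2) = t := hta
              linarith
            · linarith
          have hd0 : 0 ≤ dBeta (phi μ) (a.1, a.2) := haP.2
          linarith
        rcases lt_trichotomy a.2 b.2 with h | h | h
        · exact key a b haP hbP h1ab h
        · exact hab (Prod.ext h1ab h)
        · exact key b a hbP haP h1ab.symm h
      · have hcφ' : phi μ c < t := by
          have := phi_mid_lt hμ.1 h2 h3 (a.1, β) (b.1, β') (fun h => h1ab (Prod.mk.inj h).1)
          rw [← hcdef] at this
          linarith
        -- go down
        have hcur : Tendsto (fun e : ℝ => phi μ (c.1, c.2 - e)) (nhds 0)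
            (nhds (phi μ (c.1, c.2 - 0))) := Continuous.tendsto (by fun_prop) _
        rw [sub_zero] at hcur
        have hev := hcur.eventually (gt_mem_nhds (show phi μ (c.1, c.2) < t from hcφ'))
        obtain ⟨ε, hε, hball⟩ := Metric.eventually_nhds_iff.mp hev
        have h5 := hball (y := ε / 2) (by
          rw [Real.dist_eq, sub_zero, abs_of_pos (by linarith)]; linarith)
        have h6 : phi μ₀ (c.1, c.2 - ε / 2) < t :=
          lt_of_lt_of_le (phi0_strict hμ.1 hμ₀.1 h0 h1 h3' c.1 c.2 (ε / 2) (by linarith)) hcφ₀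
        have hcur2 : Tendsto (fun e : ℝ => max (phi μ (c.1 + e • q.1, c.2 - ε / 2))
            (phi μ₀ (c.1 + e • q.1, c.2 - ε / 2))) (nhds 0)
            (nhds (max (phi μ (c.1 + (0:ℝ) • q.1, c.2 - ε / 2))
            (phi μ₀ (c.1 + (0:ℝ) • q.1, c.2 - ε / 2)))) := Continuous.tendsto (by fun_prop) _
        rw [zero_smul, add_zero] at hcur2
        have hev2 := hcur2.eventually (gt_mem_nhds (max_lt h5 h6))
        obtain ⟨δ, hδ, hball2⟩ := Metric.eventually_nhds_iff.mp hev2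
        have h7 := hball2 (y := δ / 2) (by
          rw [Real.dist_eq, sub_zero, abs_of_pos (by linarith)]; linarith)
        rw [max_lt_iff] at h7
        have h8 := hVmax (c.1 + (δ / 2) • q.1, c.2 - ε / 2)
          ⟨(hTh _).mpr ⟨c.2 - ε / 2, h7.1.le, h7.2.le⟩, h7.1.le⟩
        have h9 := hq0 hq2.symm
        have h10 : 0 < δ / 2 * ∑ i, q.1 i * q.1 i := by positivity
        rw [← hqm] at h8
        simp only [dotR, ← hq2, hm1, zero_mul, add_zero, Pi.add_apply, Pi.smul_apply, smul_eq_mul,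
          mul_add, Finset.sum_add_distrib] at h8
        have h11 : ∑ i, q.1 i * (δ / 2 * q.1 i) = δ / 2 * ∑ i, q.1 i * q.1 i := by
          rw [Finset.mul_sum]; exact Finset.sum_congr rfl fun i _ => by ring
        rw [h11] at h8
        linarith

end RWHalfspace
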